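/- Let Ω ⊂ ℝ^d be a bounded Lipschitz domain with diam(Ω) ≤ 1/4 and 0 ∈ Ω, and let A ∈ Λ(μ,λ,τ). Then there exists a coefficient matrix Ā ∈ Λ(μ,λ₀,τ₀) such that: Ā = A on ∂Ω; Ā ∈ C¹([−1/2,1/2]^d∖∂Ω) with |∇Ā(X)| ≤ C₁ dist(X,∂Ω)^{λ₀−1} for all X ∈ [−1/2,1/2]^d∖∂Ω; and if A* = A then (Ā)* = Ā. Here λ₀ ∈ (0,λ], and τ₀, C₁ depend only on μ, λ, τ and the Lipschitz character of Ω. -/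

import Mathlib

open MeasureTheory Metric Filter Set
open scoped ENNReal NNReal Topology MeasureTheory

noncomputable section

/-- A coefficient matrix `A(X) = (a_{ij}^{αβ}(X))`. -/
abbrev Coeff (d m : ℕ) :=
  EuclideanSpace ℝ (Fin d) → Fin d → Fin d → Fin m → Fin m → ℝ

/-- The ellipticity condition `μ|ξ|² ≤ a_{ij}^{αβ} ξ_i^α ξ_j^β ≤ μ⁻¹|ξ|²`. -/
def IsElliptic {d m : ℕ} (μ : ℝ) (A : Coeff d m) : Prop :=
  ∀ (X : EuclideanSpace ℝ (Fin d)) (ξ : Fin d → Fin m → ℝ),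
    μ * (∑ i, ∑ α, (ξ i α) ^ 2) ≤ (∑ i, ∑ j, ∑ α, ∑ β, A X i j α β * ξ i α * ξ j β) ∧
    (∑ i, ∑ j, ∑ α, ∑ β, A X i j α β * ξ i α * ξ j β) ≤ μ⁻¹ * (∑ i, ∑ α, (ξ i α) ^ 2)

/-- Periodicity with respect to `ℤ^d`. -/
def IsPeriodicCoeff {d m : ℕ} (A : Coeff d m) : Prop :=
  ∀ (X Z : EuclideanSpace ℝ (Fin d)), (∀ i, ∃ k : ℤ, Z i = (k : ℝ)) → A (X + Z) = A X

/-- The Hölder condition `|A(X) − A(Y)| ≤ τ|X−Y|^λ`. -/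
def IsHolderCoeff {d m : ℕ} (lam τ : ℝ) (A : Coeff d m) : Prop :=
  ∀ X Y i j α β, |A X i j α β - A Y i j α β| ≤ τ * ‖X - Y‖ ^ lam

/-- Membership in the class `Λ(μ,λ,τ)`. -/
def MemLambdaClass {d m : ℕ} (μ lam τ : ℝ) (A : Coeff d m) : Prop :=
  IsElliptic μ A ∧ IsPeriodicCoeff A ∧ IsHolderCoeff lam τ A

/-- The symmetry condition `A* = A`. -/
def IsSymmCoeff {d m : ℕ} (A : Coeff d m) : Prop :=
  ∀ X i j α β, A X i j α β = A X j i β α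

/-- Surface measure on `∂Ω`: the `(d−1)`-dimensional Hausdorff measure restricted to the
topological boundary. -/
def surfMeasure (d : ℕ) (Ω : Set (EuclideanSpace ℝ (Fin d))) :
    Measure (EuclideanSpace ℝ (Fin d)) :=
  (μH[(d : ℝ) - 1]).restrict (frontier Ω)

/-- `Ω` is a bounded Lipschitz domain of character `(M,N)`: the boundary is covered by `N`
balls in which, after choosing a unit direction `e`, `Ω` coincides with the region above the
graph of an `M`-Lipschitz function `ψ` with `ψ(0) = 0`. -/
def MemLipschitzClass (d : ℕ) (M : ℝ) (N : ℕ)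
    (Ω : Set (EuclideanSpace ℝ (Fin d))) : Prop :=
  IsOpen Ω ∧ Bornology.IsBounded Ω ∧ Ω.Nonempty ∧
  ∃ r > 0, ∃ P : Fin N → EuclideanSpace ℝ (Fin d),
    (∀ k, P k ∈ frontier Ω) ∧
    frontier Ω ⊆ ⋃ k, Metric.ball (P k) r ∧
    (∀ k, ∃ e : EuclideanSpace ℝ (Fin d), ‖e‖ = 1 ∧
      ∃ ψ : ((Submodule.span ℝ {e})ᗮ : Submodule ℝ (EuclideanSpace ℝ (Fin d))) → ℝ,
        LipschitzWith (Real.toNNReal M) ψ ∧ ψ 0 = 0 ∧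
        ∀ X ∈ Metric.ball (P k) (10 * (M + 1) * r),
          (X ∈ Ω ↔
            ψ (Submodule.orthogonalProjectionOnto ((Submodule.span ℝ {e})ᗮ) (X - P k)) <
              (inner ℝ (X - P k) e : ℝ)))

/-- Nontangential approach region with aperture `C₀` inside `S`, relative to boundary `B`. -/
def ntRegion {d : ℕ} (C₀ : ℝ) (S B : Set (EuclideanSpace ℝ (Fin d)))
    (P : EuclideanSpace ℝ (Fin d)) : Set (EuclideanSpace ℝ (Fin d)) :=
  {X | X ∈ S ∧ dist X P < C₀ * Metric.infDist X B}

/-- Nontangential maximal function (with values in `ℝ≥0∞`). -/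
def ntMax {d : ℕ} {F : Type*} [NormedAddCommGroup F] (C₀ : ℝ)
    (S B : Set (EuclideanSpace ℝ (Fin d))) (u : EuclideanSpace ℝ (Fin d) → F)
    (P : EuclideanSpace ℝ (Fin d)) : ℝ≥0∞ :=
  ⨆ X ∈ ntRegion C₀ S B P, (‖u X‖₊ : ℝ≥0∞)

/-- Nontangential convergence of `u` to the value `v` at the boundary point `P`. -/
def NTLim {d : ℕ} {F : Type*} [TopologicalSpace F] (C₀ : ℝ)
    (S B : Set (EuclideanSpace ℝ (Fin d))) (u : EuclideanSpace ℝ (Fin d) → F)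
    (P : EuclideanSpace ℝ (Fin d)) (v : F) : Prop :=
  Filter.Tendsto u (nhdsWithin P (ntRegion C₀ S B P)) (nhds v)

/-- `u` is a weak solution of `−div(A∇u) = 0` in `Ω`. -/
def IsWeakSolution {d m : ℕ} (A : Coeff d m) (Ω : Set (EuclideanSpace ℝ (Fin d)))
    (u : EuclideanSpace ℝ (Fin d) → Fin m → ℝ) : Prop :=
  (∀ X ∈ Ω, DifferentiableAt ℝ u X) ∧
  ∀ φ : EuclideanSpace ℝ (Fin d) → Fin m → ℝ,
    ContDiff ℝ (⊤ : ℕ∞) φ → HasCompactSupport φ → tsupport φ ⊆ Ω →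
    ∫ X in Ω, ∑ i, ∑ j, ∑ α, ∑ β,
      A X i j α β * fderiv ℝ u X (EuclideanSpace.single j 1) β *
        fderiv ℝ φ X (EuclideanSpace.single i 1) α = 0

/-- `Γ` is the matrix of fundamental solutions for `−div(A∇)` in `ℝ^d`:  it is differentiable
off the diagonal, satisfies the natural size estimates, and the representation formula
`φ^γ(Y) = ∫ a_{ij}^{αβ} ∂_j Γ^{βγ}(·,Y) ∂_i φ^α`. -/
def IsFundamentalSolution {d m : ℕ} (A : Coeff d m)
    (Γ : EuclideanSpace ℝ (Fin d) → EuclideanSpace ℝ (Fin d) → Fin m → Fin m → ℝ) : Prop :=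
  (∀ X Y : EuclideanSpace ℝ (Fin d), X ≠ Y → ∀ α β,
      DifferentiableAt ℝ (fun Z => Γ Z Y α β) X ∧
      DifferentiableAt ℝ (fun Z => Γ X Z α β) Y) ∧
  (∃ C > 0, ∀ X Y : EuclideanSpace ℝ (Fin d), X ≠ Y → ∀ α β,
      |Γ X Y α β| ≤ C * ‖X - Y‖ ^ ((2 : ℝ) - d) ∧
      ‖fderiv ℝ (fun Z => Γ Z Y α β) X‖ + ‖fderiv ℝ (fun Z => Γ X Z α β) Y‖ ≤
        C * ‖X - Y‖ ^ ((1 : ℝ) - d)) ∧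
  ∀ φ : EuclideanSpace ℝ (Fin d) → Fin m → ℝ,
    ContDiff ℝ (⊤ : ℕ∞) φ → HasCompactSupport φ → ∀ Y γ,
      φ Y γ = ∫ X, ∑ i, ∑ j, ∑ α, ∑ β,
        A X i j α β * fderiv ℝ (fun Z => Γ Z Y β γ) X (EuclideanSpace.single j 1) *
          fderiv ℝ φ X (EuclideanSpace.single i 1) α

/-- `n` is the (a.e. defined) outward unit normal of `Ω`, characterized by the
Gauss–Green formula. -/
def IsOutwardNormal {d : ℕ} (Ω : Set (EuclideanSpace ℝ (Fin d)))
    (n : EuclideanSpace ℝ (Fin d) → EuclideanSpace ℝ (Fin d)) : Prop :=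
  (∀ᵐ P ∂(surfMeasure d Ω), ‖n P‖ = 1) ∧
  ∀ φ : EuclideanSpace ℝ (Fin d) → EuclideanSpace ℝ (Fin d),
    ContDiff ℝ (⊤ : ℕ∞) φ → HasCompactSupport φ →
    ∫ X in Ω, ∑ i, fderiv ℝ φ X (EuclideanSpace.single i 1) i =
      ∫ P, ∑ i, φ P i * n P i ∂(surfMeasure d Ω)

/-- The `(α,i)` entry of a total derivative `G`, i.e. `∂u^α/∂x_i`. -/
def gradEntry {d m : ℕ} (G : EuclideanSpace ℝ (Fin d) →L[ℝ] (Fin m → ℝ))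
    (α : Fin m) (i : Fin d) : ℝ :=
  G (EuclideanSpace.single i 1) α

/-- `|∇u|²` computed from a total derivative. -/
def gradNormSq {d m : ℕ} (G : EuclideanSpace ℝ (Fin d) →L[ℝ] (Fin m → ℝ)) : ℝ :=
  ∑ α, ∑ i, (gradEntry G α i) ^ 2

/-- The conormal derivative `(∂u/∂ν)^α = n_i a_{ij}^{αβ} ∂_j u^β` computed from a total
derivative `G` at the boundary point `P`. -/
def conormalDeriv {d m : ℕ} (A : Coeff d m)
    (n : EuclideanSpace ℝ (Fin d) → EuclideanSpace ℝ (Fin d))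
    (P : EuclideanSpace ℝ (Fin d)) (G : EuclideanSpace ℝ (Fin d) →L[ℝ] (Fin m → ℝ))
    (α : Fin m) : ℝ :=
  ∑ i, ∑ j, ∑ β, n P i * A P i j α β * gradEntry G β j

/-- `|∂u/∂ν|²`. -/
def conormalNormSq {d m : ℕ} (A : Coeff d m)
    (n : EuclideanSpace ℝ (Fin d) → EuclideanSpace ℝ (Fin d))
    (P : EuclideanSpace ℝ (Fin d)) (G : EuclideanSpace ℝ (Fin d) →L[ℝ] (Fin m → ℝ)) : ℝ :=
  ∑ α, (conormalDeriv A n P G α) ^ 2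

/-- `|∇_tan u|²`: the squared norm of the tangential part of the gradient. -/
def tanGradNormSq {d m : ℕ} (nP : EuclideanSpace ℝ (Fin d))
    (G : EuclideanSpace ℝ (Fin d) →L[ℝ] (Fin m → ℝ)) : ℝ :=
  ∑ α, ∑ i, (gradEntry G α i - (∑ k, gradEntry G α k * nP k) * nP i) ^ 2

/-- `|∇u(X)|²` for a function `u`. -/
def gradSq {d m : ℕ} (u : EuclideanSpace ℝ (Fin d) → Fin m → ℝ)
    (X : EuclideanSpace ℝ (Fin d)) : ℝ :=
  ∑ α, ∑ i, (fderiv ℝ u X (EuclideanSpace.single i 1) α) ^ 2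

/-- Single layer potential with density `g`. -/
def singleLayer {d m : ℕ} (Ω : Set (EuclideanSpace ℝ (Fin d)))
    (Γ : EuclideanSpace ℝ (Fin d) → EuclideanSpace ℝ (Fin d) → Fin m → Fin m → ℝ)
    (g : EuclideanSpace ℝ (Fin d) → Fin m → ℝ)
    (X : EuclideanSpace ℝ (Fin d)) : Fin m → ℝ :=
  fun α => ∫ Y, ∑ β, Γ X Y α β * g Y β ∂(surfMeasure d Ω)

/-- Double layer potential with density `f`. -/
def doubleLayer {d m : ℕ} (Ω : Set (EuclideanSpace ℝ (Fin d))) (A : Coeff d m)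
    (n : EuclideanSpace ℝ (Fin d) → EuclideanSpace ℝ (Fin d))
    (Γ : EuclideanSpace ℝ (Fin d) → EuclideanSpace ℝ (Fin d) → Fin m → Fin m → ℝ)
    (f : EuclideanSpace ℝ (Fin d) → Fin m → ℝ)
    (X : EuclideanSpace ℝ (Fin d)) : Fin m → ℝ :=
  fun α => ∫ Y, ∑ i, ∑ j, ∑ β, ∑ γ,
    n Y j * A Y i j β γ *
      fderiv ℝ (fun Z => Γ X Z α β) Y (EuclideanSpace.single i 1) * f Y γ
    ∂(surfMeasure d Ω)

/-- Identity coefficient matrix. -/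
def idCoeff (d m : ℕ) : Coeff d m :=
  fun _ i j α β => if i = j ∧ α = β then 1 else 0

/-- A solution of the `L²` Dirichlet problem with data `f`. -/
def IsDirichletSolution {d m : ℕ} (C₀ : ℝ) (A : Coeff d m)
    (Ω : Set (EuclideanSpace ℝ (Fin d)))
    (f u : EuclideanSpace ℝ (Fin d) → Fin m → ℝ) : Prop :=
  IsWeakSolution A Ω u ∧
  (∫⁻ P, (ntMax C₀ Ω (frontier Ω) u P) ^ 2 ∂(surfMeasure d Ω)) ≠ ⊤ ∧
  ∀ᵐ P ∂(surfMeasure d Ω), NTLim C₀ Ω (frontier Ω) u P (f P)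

/-- A solution of the `L²` regularity problem with data `f`. -/
def IsRegularitySolution {d m : ℕ} (C₀ : ℝ) (A : Coeff d m)
    (Ω : Set (EuclideanSpace ℝ (Fin d)))
    (f u : EuclideanSpace ℝ (Fin d) → Fin m → ℝ) : Prop :=
  IsWeakSolution A Ω u ∧
  (∫⁻ P, (ntMax C₀ Ω (frontier Ω) (fun X => fderiv ℝ u X) P) ^ 2 ∂(surfMeasure d Ω)) ≠ ⊤ ∧
  ∀ᵐ P ∂(surfMeasure d Ω), NTLim C₀ Ω (frontier Ω) u P (f P)

/-- A solution of the `L²` Neumann problem with data `f`: the conormal derivative attains `f`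
as a nontangential limit a.e. -/
def IsNeumannSolution {d m : ℕ} (C₀ : ℝ) (A : Coeff d m)
    (Ω : Set (EuclideanSpace ℝ (Fin d)))
    (n : EuclideanSpace ℝ (Fin d) → EuclideanSpace ℝ (Fin d))
    (f u : EuclideanSpace ℝ (Fin d) → Fin m → ℝ) : Prop :=
  IsWeakSolution A Ω u ∧
  (∫⁻ P, (ntMax C₀ Ω (frontier Ω) (fun X => fderiv ℝ u X) P) ^ 2 ∂(surfMeasure d Ω)) ≠ ⊤ ∧
  ∀ᵐ P ∂(surfMeasure d Ω),
    ∃ G, NTLim C₀ Ω (frontier Ω) (fun X => fderiv ℝ u X) P G ∧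
      ∀ α, conormalDeriv A n P G α = f P α

/-- Unique solvability of the `L²` Dirichlet problem with estimate `‖(u)*‖₂ ≤ C‖f‖₂`. -/
def SolvesDirichlet {d m : ℕ} (C₀ : ℝ) (A : Coeff d m)
    (Ω : Set (EuclideanSpace ℝ (Fin d))) (C : ℝ) : Prop :=
  ∀ f : EuclideanSpace ℝ (Fin d) → Fin m → ℝ, MemLp f 2 (surfMeasure d Ω) →
    ∃ u, IsDirichletSolution C₀ A Ω f u ∧
      (∀ v, IsDirichletSolution C₀ A Ω f v → Set.EqOn v u Ω) ∧
      (∫⁻ P, (ntMax C₀ Ω (frontier Ω) u P) ^ 2 ∂(surfMeasure d Ω)) ^ ((1 : ℝ) / 2) ≤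
        ENNReal.ofReal C * eLpNorm f 2 (surfMeasure d Ω)

/-- Unique solvability of the `L²` regularity problem with estimate
`‖(∇u)*‖₂ ≤ C‖∇_tan f‖₂`; the data is `f ∈ W^{1,2}(∂Ω)` together with its tangential
gradient `ft`. -/
def SolvesRegularity {d m : ℕ} (C₀ : ℝ) (A : Coeff d m)
    (Ω : Set (EuclideanSpace ℝ (Fin d))) (C : ℝ) : Prop :=
  ∀ (f : EuclideanSpace ℝ (Fin d) → Fin m → ℝ)
    (ft : EuclideanSpace ℝ (Fin d) → (EuclideanSpace ℝ (Fin d) →L[ℝ] (Fin m → ℝ))),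
    MemLp f 2 (surfMeasure d Ω) → MemLp ft 2 (surfMeasure d Ω) →
    (∀ᵐ P ∂(surfMeasure d Ω), HasFDerivWithinAt f (ft P) (frontier Ω) P) →
    ∃ u, IsRegularitySolution C₀ A Ω f u ∧
      (∀ v, IsRegularitySolution C₀ A Ω f v → Set.EqOn v u Ω) ∧
      (∫⁻ P, (ntMax C₀ Ω (frontier Ω) (fun X => fderiv ℝ u X) P) ^ 2
          ∂(surfMeasure d Ω)) ^ ((1 : ℝ) / 2) ≤
        ENNReal.ofReal C * eLpNorm ft 2 (surfMeasure d Ω)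

/-- Unique (up to constants) solvability of the `L²` Neumann problem with estimate
`‖(∇u)*‖₂ ≤ C‖f‖₂`. -/
def SolvesNeumann {d m : ℕ} (C₀ : ℝ) (A : Coeff d m)
    (Ω : Set (EuclideanSpace ℝ (Fin d)))
    (n : EuclideanSpace ℝ (Fin d) → EuclideanSpace ℝ (Fin d)) (C : ℝ) : Prop :=
  ∀ f : EuclideanSpace ℝ (Fin d) → Fin m → ℝ, MemLp f 2 (surfMeasure d Ω) →
    (∀ α, ∫ P, f P α ∂(surfMeasure d Ω) = 0) →
    ∃ u, IsNeumannSolution C₀ A Ω n f u ∧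
      (∀ v, IsNeumannSolution C₀ A Ω n f v →
        ∃ c : Fin m → ℝ, ∀ X ∈ Ω, ∀ α, v X α = u X α + c α) ∧
      (∫⁻ P, (ntMax C₀ Ω (frontier Ω) (fun X => fderiv ℝ u X) P) ^ 2
          ∂(surfMeasure d Ω)) ^ ((1 : ℝ) / 2) ≤
        ENNReal.ofReal C * eLpNorm f 2 (surfMeasure d Ω)

/-- The Rellich property of `−div(A∇)` in `Ω` with constant `C`. -/
def HasRellichProperty {d m : ℕ} (C₀ : ℝ) (A : Coeff d m)
    (Ω : Set (EuclideanSpace ℝ (Fin d))) (C : ℝ) : Prop :=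
  ∀ n, IsOutwardNormal Ω n →
  ∀ (u : EuclideanSpace ℝ (Fin d) → Fin m → ℝ)
    (G : EuclideanSpace ℝ (Fin d) → (EuclideanSpace ℝ (Fin d) →L[ℝ] (Fin m → ℝ))),
    IsWeakSolution A Ω u →
    (∫⁻ P, (ntMax C₀ Ω (frontier Ω) (fun X => fderiv ℝ u X) P) ^ 2 ∂(surfMeasure d Ω)) ≠ ⊤ →
    (∀ᵐ P ∂(surfMeasure d Ω), NTLim C₀ Ω (frontier Ω) (fun X => fderiv ℝ u X) P (G P)) →
    Real.sqrt (∫ P, gradNormSq (G P) ∂(surfMeasure d Ω)) ≤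
        C * Real.sqrt (∫ P, conormalNormSq A n P (G P) ∂(surfMeasure d Ω)) ∧
    Real.sqrt (∫ P, gradNormSq (G P) ∂(surfMeasure d Ω)) ≤
        C * Real.sqrt (∫ P, tanGradNormSq (n P) (G P) ∂(surfMeasure d Ω))

/-- Truncated singular integral with kernel `∇₁Γ(P,Y)` acting on `f`. -/
def trunc1 {d m : ℕ} (Ω : Set (EuclideanSpace ℝ (Fin d)))
    (Γ : EuclideanSpace ℝ (Fin d) → EuclideanSpace ℝ (Fin d) → Fin m → Fin m → ℝ)
    (f : EuclideanSpace ℝ (Fin d) → Fin m → ℝ) (ρ : ℝ)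
    (P : EuclideanSpace ℝ (Fin d)) : Fin m → Fin d → ℝ :=
  fun α i => ∫ Y in {Y | ρ < dist Y P}, ∑ β,
    fderiv ℝ (fun Z => Γ Z Y α β) P (EuclideanSpace.single i 1) * f Y β ∂(surfMeasure d Ω)

/-- Truncated singular integral with kernel `∇₂Γ(P,Y)` acting on `f`. -/
def trunc2 {d m : ℕ} (Ω : Set (EuclideanSpace ℝ (Fin d)))
    (Γ : EuclideanSpace ℝ (Fin d) → EuclideanSpace ℝ (Fin d) → Fin m → Fin m → ℝ)
    (f : EuclideanSpace ℝ (Fin d) → Fin m → ℝ) (ρ : ℝ)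
    (P : EuclideanSpace ℝ (Fin d)) : Fin m → Fin d → ℝ :=
  fun α i => ∫ Y in {Y | ρ < dist Y P}, ∑ β,
    fderiv ℝ (fun Z => Γ P Z α β) Y (EuclideanSpace.single i 1) * f Y β ∂(surfMeasure d Ω)

/-- Maximal singular integral associated with `trunc1`. -/
def maxTrunc1 {d m : ℕ} (Ω : Set (EuclideanSpace ℝ (Fin d)))
    (Γ : EuclideanSpace ℝ (Fin d) → EuclideanSpace ℝ (Fin d) → Fin m → Fin m → ℝ)
    (f : EuclideanSpace ℝ (Fin d) → Fin m → ℝ)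
    (P : EuclideanSpace ℝ (Fin d)) : ℝ≥0∞ :=
  ⨆ ρ ∈ Set.Ioi (0 : ℝ), (‖trunc1 Ω Γ f ρ P‖₊ : ℝ≥0∞)

/-- Maximal singular integral associated with `trunc2`. -/
def maxTrunc2 {d m : ℕ} (Ω : Set (EuclideanSpace ℝ (Fin d)))
    (Γ : EuclideanSpace ℝ (Fin d) → EuclideanSpace ℝ (Fin d) → Fin m → Fin m → ℝ)
    (f : EuclideanSpace ℝ (Fin d) → Fin m → ℝ)
    (P : EuclideanSpace ℝ (Fin d)) : ℝ≥0∞ :=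
  ⨆ ρ ∈ Set.Ioi (0 : ℝ), (‖trunc2 Ω Γ f ρ P‖₊ : ℝ≥0∞)

/-- Truncated version of the adjoint operator `K*_B`, the kernel being
`∑ K_B^{βα}(Y,P) f^β(Y)` where `K_B^{βα}(Y,P) = n_i(Y) b_{ij}^{βγ}(Y) ∂_{Y_j}Γ_B^{γα}(Y,P)`. -/
def truncKadj {d m : ℕ} (Ω : Set (EuclideanSpace ℝ (Fin d))) (B : Coeff d m)
    (n : EuclideanSpace ℝ (Fin d) → EuclideanSpace ℝ (Fin d))
    (Γ : EuclideanSpace ℝ (Fin d) → EuclideanSpace ℝ (Fin d) → Fin m → Fin m → ℝ)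
    (f : EuclideanSpace ℝ (Fin d) → Fin m → ℝ) (ρ : ℝ)
    (P : EuclideanSpace ℝ (Fin d)) : Fin m → ℝ :=
  fun α => ∫ Y in {Y | ρ < dist Y P}, ∑ β, ∑ i, ∑ j, ∑ γ,
    n Y i * B Y i j β γ *
      fderiv ℝ (fun Z => Γ Z P γ α) Y (EuclideanSpace.single j 1) * f Y β
    ∂(surfMeasure d Ω)

/-- The first `e` coordinates of a point of `ℝ^{e+1}`. -/
def projLast (e : ℕ) (X : EuclideanSpace ℝ (Fin (e + 1))) : EuclideanSpace ℝ (Fin e) :=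
  WithLp.toLp 2 fun i => X i.castSucc

/-- The domain above the graph of `ψ`. -/
def graphDomain (e : ℕ) (ψ : EuclideanSpace ℝ (Fin e) → ℝ) :
    Set (EuclideanSpace ℝ (Fin (e + 1))) :=
  {X | ψ (projLast e X) < X (Fin.last e)}

/-- The surface ball `Δ(r)` on the graph of `ψ`. -/
def graphDelta (e : ℕ) (ψ : EuclideanSpace ℝ (Fin e) → ℝ) (r : ℝ) :
    Set (EuclideanSpace ℝ (Fin (e + 1))) :=
  {X | X (Fin.last e) = ψ (projLast e X) ∧ ‖projLast e X‖ < r}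

/-- The region `D(r)` above the graph of `ψ`. -/
def graphD (e : ℕ) (M : ℝ) (ψ : EuclideanSpace ℝ (Fin e) → ℝ) (r : ℝ) :
    Set (EuclideanSpace ℝ (Fin (e + 1))) :=
  {X | ‖projLast e X‖ < r ∧ ψ (projLast e X) < X (Fin.last e) ∧
    X (Fin.last e) < 10 * Real.sqrt (e + 1) * (M + 1) * r}

section helpers

abbrev EE (d : ℕ) := EuclideanSpace ℝ (Fin d)

lemma hasDerivAt_max_sq (t : ℝ) : HasDerivAt (fun s : ℝ => (max 0 s) ^ 2) (2 * max 0 t) t := by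
  rw [hasDerivAt_iff_isLittleO]
  have h1 : (fun s : ℝ => (max 0 s) ^ 2 - (max 0 t) ^ 2 - (s - t) • (2 * max 0 t))
      =O[𝓝 t] (fun s => (s - t) ^ 2) := by
    refine Asymptotics.IsBigO.of_bound 1 (Eventually.of_forall fun s => ?_)
    rw [Real.norm_eq_abs, Real.norm_eq_abs, one_mul, abs_of_nonneg (sq_nonneg (s - t)), smul_eq_mul, abs_le]
    rcases le_total 0 s with hs | hs <;> rcases le_total 0 t with ht | ht <;>
      simp only [max_eq_right, max_eq_left, hs, ht] <;> constructor <;> nlinarith [mul_nonneg_of_nonpos_of_nonpos (sub_nonpos.2 hs) (sub_nonpos.2 ht), mul_nonpos_of_nonneg_of_nonpos (sub_nonneg.2 ht) (sub_nonpos.2 hs)]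
  refine h1.trans_isLittleO ?_
  have h2 : (fun s : ℝ => (s - t) ^ 2) = fun s => (s - t) * (s - t) := by ext; ring
  rw [h2]
  have h3 : (fun s : ℝ => s - t) =o[𝓝 t] (fun _ => (1 : ℝ)) := by
    rw [Asymptotics.isLittleO_one_iff]
    have : Tendsto (fun s : ℝ => s - t) (𝓝 t) (𝓝 (t - t)) := (continuous_id.sub continuous_const).tendsto t
    simpa using this
  simpa using h3.mul_isBigO (Asymptotics.isBigO_refl (fun s : ℝ => s - t) (𝓝 t))

/-- positive part -/
def pp {d : ℕ} (δ : EE d → ℝ) (X Y : EE d) : ℝ := max 0 (δ Y ^ 2 / 4 - ‖X - Y‖ ^ 2)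
def wt {d : ℕ} (δ : EE d → ℝ) (X Y : EE d) : ℝ := (pp δ X Y) ^ 2
def dw {d : ℕ} (δ : EE d → ℝ) (X Y : EE d) : EE d →L[ℝ] ℝ :=
  (2 * pp δ X Y) • (-((2 : ℝ) • innerSL ℝ (X - Y)))

lemma hasFDerivAt_wt {d : ℕ} (δ : EE d → ℝ) (X Y : EE d) :
    HasFDerivAt (fun X => wt δ X Y) (dw δ X Y) X := by
  have h1 : HasFDerivAt (fun X : EE d => δ Y ^ 2 / 4 - ‖X - Y‖ ^ 2)
      (-((2 : ℝ) • innerSL ℝ (X - Y))) X := by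
    have := (((hasFDerivAt_id X).sub_const Y).norm_sq).const_sub (δ Y ^ 2 / 4)
    refine this.congr_fderiv ?_
    ext v; simp
  exact (hasDerivAt_max_sq _).comp_hasFDerivAt X h1

lemma pp_nonneg {d : ℕ} (δ : EE d → ℝ) (X Y : EE d) : 0 ≤ pp δ X Y := le_max_left _ _

/-- Assumptions on the distance function -/
structure IsDistLike {d : ℕ} (δ : EE d → ℝ) : Prop where
  nn : ∀ X, 0 ≤ δ X
  lip : ∀ X Y, δ X ≤ δ Y + ‖X - Y‖

variable {d : ℕ} {δ : EE d → ℝ}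

lemma IsDistLike.continuous (h : IsDistLike δ) : Continuous δ := by
  have : LipschitzWith 1 δ := LipschitzWith.of_le_add fun X Y => by
    rw [dist_eq_norm]; exact h.lip X Y
  exact this.continuous

lemma pp_supp (h : IsDistLike δ) {X Y : EE d} (hp : pp δ X Y ≠ 0) :
    ‖X - Y‖ ≤ δ X ∧ δ Y ≤ 2 * δ X := by
  have h1 : 0 < δ Y ^ 2 / 4 - ‖X - Y‖ ^ 2 := by
    by_contra hc
    exact hp (max_eq_left (not_lt.1 hc))
  have h2 : ‖X - Y‖ < δ Y / 2 := by
    apply lt_of_pow_lt_pow_left₀ 2 (by have := h.nn Y; positivity)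
    linarith [show (δ Y / 2) ^ 2 = δ Y ^ 2 / 4 by ring]
  have h3 := h.lip Y X
  rw [norm_sub_rev] at h3
  constructor <;> linarith

lemma pp_le (h : IsDistLike δ) (X Y : EE d) : pp δ X Y ≤ δ X ^ 2 := by
  by_cases hp : pp δ X Y = 0
  · rw [hp]; positivity
  · have h1 := (pp_supp h hp).2
    have := h.nn Y
    refine max_le (by positivity) ?_
    nlinarith [sq_nonneg ‖X - Y‖]

lemma norm_dw_le (h : IsDistLike δ) (X Y : EE d) : ‖dw δ X Y‖ ≤ 4 * δ X ^ 3 := by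
  have hX := h.nn X
  by_cases hp : pp δ X Y = 0
  · simp only [dw, hp]; simp; positivity
  · have h1 := (pp_supp h hp).1
    have h2 := pp_le h X Y
    have h3 := pp_nonneg δ X Y
    have : ‖dw δ X Y‖ = 2 * pp δ X Y * (2 * ‖X - Y‖) := by
      rw [dw, norm_smul, norm_neg, norm_smul, innerSL_apply_norm, Real.norm_of_nonneg (by positivity)]
      simp
    rw [this]
    have := mul_le_mul h2 h1 (norm_nonneg _) (by positivity)
    nlinarith

lemma wt_eq_zero (h : IsDistLike δ) {X Y : EE d} (hY : δ X < ‖X - Y‖) : pp δ X Y = 0 := by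
  by_contra hp
  exact absurd (pp_supp h hp).1 (not_le.2 hY)

lemma wt_lower (h : IsDistLike δ) {X Y : EE d} (hY : ‖X - Y‖ ≤ δ X / 8) :
    δ X ^ 4 / 64 ≤ wt δ X Y := by
  have h1 := h.lip X Y
  have h2 := h.nn X
  have h3 : 7 / 8 * δ X ≤ δ Y := by linarith
  have h4 : δ X ^ 2 / 8 ≤ pp δ X Y := by
    refine le_trans ?_ (le_max_right _ _)
    have a1 : ‖X - Y‖ ^ 2 ≤ (δ X / 8) ^ 2 := pow_le_pow_left₀ (norm_nonneg _) hY 2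
    have a2 : (7 / 8 * δ X) ^ 2 ≤ δ Y ^ 2 := pow_le_pow_left₀ (by positivity) h3 2
    nlinarith [sq_nonneg (δ X)]
  have := pow_le_pow_left₀ (by positivity) h4 2
  rw [wt]
  calc _ = (δ X ^ 2 / 8) ^ 2 := by ring
    _ ≤ _ := this

lemma continuous_pp (h : IsDistLike δ) (X : EE d) : Continuous (fun Y => pp δ X Y) := by
  have := h.continuous
  unfold pp; fun_prop

lemma continuous_wt (h : IsDistLike δ) (X : EE d) : Continuous (fun Y => wt δ X Y) :=
  (continuous_pp h X).pow 2

lemma continuous_dw (h : IsDistLike δ) (X : EE d) : Continuous (fun Y => dw δ X Y) := by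
  have := continuous_pp h X
  unfold dw
  have h2 : Continuous fun Y : EE d => innerSL ℝ (X - Y) :=
    (innerSL ℝ).continuous.comp (continuous_const.sub continuous_id)
  have h3 : Continuous fun Y : EE d => -((2 : ℝ) • innerSL ℝ (X - Y)) := (h2.const_smul (2 : ℝ)).neg
  exact (continuous_const.mul this).smul h3

lemma pp_hcs (h : IsDistLike δ) (X : EE d) : HasCompactSupport (fun Y => pp δ X Y) := by
  refine HasCompactSupport.intro (isCompact_closedBall X (δ X)) fun Y hY => wt_eq_zero h ?_
  rw [mem_closedBall, dist_eq_norm, not_le, norm_sub_rev] at hY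
  exact hY

lemma wt_hcs (h : IsDistLike δ) (X : EE d) : HasCompactSupport (fun Y => wt δ X Y) :=
  (pp_hcs h X).comp_left (g := fun t : ℝ => t ^ 2) (by simp)

lemma dw_hcs (h : IsDistLike δ) (X : EE d) : HasCompactSupport (fun Y => dw δ X Y) := by
  refine HasCompactSupport.intro (isCompact_closedBall X (δ X)) fun Y hY => ?_
  rw [mem_closedBall, dist_eq_norm, not_le, norm_sub_rev] at hY
  simp [dw, wt_eq_zero h hY]

lemma integrable_gw (h : IsDistLike δ) {g : EE d → ℝ} (hg : Continuous g) (X : EE d) :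
    Integrable (fun Y => g Y * wt δ X Y) :=
  (hg.mul (continuous_wt h X)).integrable_of_hasCompactSupport (wt_hcs h X).mul_left

lemma integrable_w (h : IsDistLike δ) (X : EE d) : Integrable (fun Y => wt δ X Y) :=
  (continuous_wt h X).integrable_of_hasCompactSupport (wt_hcs h X)

def Nu (δ : EE d → ℝ) (g : EE d → ℝ) (X : EE d) : ℝ := ∫ Y, g Y * wt δ X Y
def Wt (δ : EE d → ℝ) (X : EE d) : ℝ := ∫ Y, wt δ X Y
def dN (δ : EE d → ℝ) (g : EE d → ℝ) (X : EE d) : EE d →L[ℝ] ℝ := ∫ Y, g Y • dw δ X Y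

lemma integrable_gdw (h : IsDistLike δ) {g : EE d → ℝ} (hg : Continuous g) (X : EE d) :
    Integrable (fun Y => g Y • dw δ X Y) :=
  (hg.smul (continuous_dw h X)).integrable_of_hasCompactSupport (dw_hcs h X).smul_left

lemma hasFDerivAt_Nu (h : IsDistLike δ) {g : EE d → ℝ} (hg : Continuous g) (X₀ : EE d) :
    HasFDerivAt (Nu δ g) (dN δ g X₀) X₀ := by
  set R := δ X₀ + 1 with hR
  have hRn : 0 ≤ R := by have := h.nn X₀; positivity
  obtain ⟨C, hC⟩ := (isCompact_closedBall X₀ (R + 1)).exists_bound_of_continuousOn hg.continuousOn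
  refine hasFDerivAt_integral_of_dominated_of_fderiv_le (F' := fun X Y => g Y • dw δ X Y)
    (bound := (closedBall X₀ (R + 1)).indicator (fun _ => C * (4 * R ^ 3))) (ball_mem_nhds X₀ one_pos)
    (Eventually.of_forall fun X => (integrable_gw h hg X).aestronglyMeasurable)
    (integrable_gw h hg X₀) (integrable_gdw h hg X₀).aestronglyMeasurable
    (Eventually.of_forall fun Y X hX => ?_) ?_
    (Eventually.of_forall fun Y X hX => ?_)
  · rw [mem_ball, dist_eq_norm] at hX
    have hXR : δ X ≤ R := by have := h.lip X X₀; linarith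
    by_cases hY : Y ∈ closedBall X₀ (R + 1)
    · rw [indicator_of_mem hY, norm_smul]
      have h1 := hC Y hY
      have h2 := norm_dw_le h X Y
      have h3 : δ X ^ 3 ≤ R ^ 3 := pow_le_pow_left₀ (h.nn X) hXR 3
      exact mul_le_mul h1 (by linarith) (norm_nonneg _) ((norm_nonneg _).trans h1)
    · rw [indicator_of_notMem hY]
      have : pp δ X Y = 0 := by
        apply wt_eq_zero h
        rw [mem_closedBall, not_le, dist_eq_norm, norm_sub_rev] at hY
        have : ‖X₀ - Y‖ ≤ ‖X - X₀‖ + ‖X - Y‖ := by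
          calc _ = ‖(X - Y) - (X - X₀)‖ := by congr 1; abel
            _ ≤ _ := by rw [add_comm]; exact norm_sub_le _ _
        linarith
      simp [dw, this]
  · exact (integrable_indicator_iff measurableSet_closedBall).2
      (integrableOn_const (isCompact_closedBall _ _).measure_lt_top.ne)
  · exact (hasFDerivAt_wt δ X Y).const_mul (g Y)

def Vol (δ : EE d → ℝ) (X : EE d) : ℝ := volume.real (closedBall X (δ X))

lemma Wt_lower (h : IsDistLike δ) (X : EE d) : δ X ^ 4 * Vol δ X ≤ 64 * 8 ^ d * Wt δ X := by
  have hX := h.nn X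
  have h1 : volume.real (closedBall X (δ X / 8)) * (δ X ^ 4 / 64) ≤ Wt δ X := by
    calc _ = ∫ Y in closedBall X (δ X / 8), (δ X ^ 4 / 64) := by
          rw [setIntegral_const, smul_eq_mul]
      _ ≤ ∫ Y in closedBall X (δ X / 8), wt δ X Y := by
          refine setIntegral_mono_on (integrableOn_const (isCompact_closedBall _ _).measure_lt_top.ne)
            (integrable_w h X).integrableOn measurableSet_closedBall fun Y hY => wt_lower h ?_
          rw [mem_closedBall, dist_eq_norm, norm_sub_rev] at hY
          exact hY
      _ ≤ _ := setIntegral_le_integral (integrable_w h X) (Eventually.of_forall fun Y => sq_nonneg _)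
  rw [Measure.addHaar_real_closedBall _ _ (by positivity), finrank_euclideanSpace_fin] at h1
  rw [Vol, Measure.addHaar_real_closedBall _ _ hX, finrank_euclideanSpace_fin]
  rw [div_pow] at h1
  have h8 : (0 : ℝ) < 8 ^ d := by positivity
  calc _ = 64 * 8 ^ d * (δ X ^ d / 8 ^ d * volume.real (ball (0 : EE d) 1) * (δ X ^ 4 / 64)) := by
        field_simp
    _ ≤ _ := by gcongr

lemma Wt_pos (h : IsDistLike δ) {X : EE d} (hX : 0 < δ X) : 0 < Wt δ X := by
  have h1 := Wt_lower h X
  have h2 : 0 < Vol δ X := by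
    refine ENNReal.toReal_pos (measure_closedBall_pos _ _ hX).ne' (isCompact_closedBall _ _).measure_lt_top.ne
  have h3 : 0 < 64 * 8 ^ d * Wt δ X := lt_of_lt_of_le (by positivity) h1
  exact pos_of_mul_pos_right h3 (by positivity)

lemma Nu_le (h : IsDistLike δ) {g : EE d → ℝ} {X : EE d} {η : ℝ}
    (hη : ∀ Y, ‖X - Y‖ ≤ δ X → |g Y| ≤ η) : |Nu δ g X| ≤ η * Wt δ X := by
  rw [Nu, Wt, ← integral_const_mul, ← Real.norm_eq_abs]
  refine norm_integral_le_of_norm_le ((integrable_w h X).const_mul η) (Eventually.of_forall fun Y => ?_)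
  rw [norm_mul, Real.norm_of_nonneg (show 0 ≤ wt δ X Y from sq_nonneg _)]
  by_cases hp : pp δ X Y = 0
  · simp [wt, hp]
  · exact mul_le_mul_of_nonneg_right (hη Y (pp_supp h hp).1) (sq_nonneg _)

lemma dN_le (h : IsDistLike δ) {g : EE d → ℝ} {X : EE d} {η : ℝ}
    (hη : ∀ Y, ‖X - Y‖ ≤ δ X → |g Y| ≤ η) : ‖dN δ g X‖ ≤ η * (4 * δ X ^ 3) * Vol δ X := by
  have hX := h.nn X
  have : dN δ g X = ∫ Y in closedBall X (δ X), g Y • dw δ X Y := by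
    rw [dN, setIntegral_eq_integral_of_forall_compl_eq_zero]
    intro Y hY
    rw [mem_closedBall, dist_eq_norm, not_le, norm_sub_rev] at hY
    simp [dw, wt_eq_zero h hY]
  rw [this]
  refine norm_setIntegral_le_of_norm_le_const (isCompact_closedBall _ _).measure_lt_top fun Y hY => ?_
  rw [mem_closedBall, dist_eq_norm, norm_sub_rev] at hY
  rw [norm_smul]
  have h1 := hη Y hY
  exact mul_le_mul h1 (norm_dw_le h X Y) (norm_nonneg _) ((abs_nonneg _).trans h1)

lemma Nu_one : Nu δ (fun _ => 1) = Wt δ := by ext X; simp [Nu, Wt]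

lemma Nu_sub_const (h : IsDistLike δ) {f : EE d → ℝ} (hf : Continuous f) (c : ℝ) (X : EE d) :
    Nu δ (fun Y => f Y - c) X = Nu δ f X - c * Wt δ X := by
  simp only [Nu, Wt, sub_mul]
  rw [integral_sub (integrable_gw h hf X) ((integrable_w h X).const_mul c), integral_const_mul]

lemma dN_sub_const (h : IsDistLike δ) {f : EE d → ℝ} (hf : Continuous f) (c : ℝ) (X : EE d) :
    dN δ (fun Y => f Y - c) X = dN δ f X - c • dN δ (fun _ => 1) X := by
  have e : ∀ Y, (f Y - c) • dw δ X Y = f Y • dw δ X Y - c • ((1 : ℝ) • dw δ X Y) := by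
    intro Y; ext v; simp; ring
  have i2 : Integrable (fun Y => c • ((1 : ℝ) • dw δ X Y)) :=
    (integrable_gdw h (continuous_const (y := (1 : ℝ))) X).smul c
  simp only [dN]
  rw [integral_congr_ae (Eventually.of_forall e), integral_sub (integrable_gdw h hf X) i2, integral_smul]

open Classical in
/-- the averaged function -/
def av (δ : EE d → ℝ) (f : EE d → ℝ) (X : EE d) : ℝ :=
  if δ X = 0 then f X else Nu δ f X / Wt δ X

lemma av_close (h : IsDistLike δ) {f : EE d → ℝ} {X : EE d} {η : ℝ} (hf : Continuous f)
    (hη : ∀ Y, ‖X - Y‖ ≤ δ X → |f Y - f X| ≤ η) (h0 : 0 ≤ η) : |av δ f X - f X| ≤ η := by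
  unfold av
  split_ifs with hX
  · simpa using h0
  · have hp := Wt_pos h (lt_of_le_of_ne (h.nn X) (Ne.symm hX))
    have h1 := Nu_le h (g := fun Y => f Y - f X) hη
    rw [Nu_sub_const h hf] at h1
    rw [div_sub' hp.ne', abs_div, abs_of_pos hp, div_le_iff₀ hp, mul_comm (Wt δ X)]
    exact h1

lemma av_deriv (h : IsDistLike δ) {f : EE d → ℝ} {X : EE d} {η : ℝ} (hf : Continuous f)
    (hη : ∀ Y, ‖X - Y‖ ≤ δ X → |f Y - f X| ≤ η) (hX : 0 < δ X) :
    DifferentiableAt ℝ (av δ f) X ∧ ‖fderiv ℝ (av δ f) X‖ ≤ 512 * 8 ^ d * η / δ X := by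
  have hW := Wt_pos h hX
  have hev : av δ f =ᶠ[𝓝 X] fun X => Nu δ f X / Wt δ X := by
    filter_upwards [h.continuous.continuousAt.eventually (lt_mem_nhds hX)] with Z hZ
    rw [av, if_neg hZ.ne']
  have hN := hasFDerivAt_Nu h hf X
  have hWd := hasFDerivAt_Nu h (continuous_const (y := (1 : ℝ))) X
  rw [Nu_one] at hWd
  have hinv := (hasDerivAt_inv hW.ne').comp_hasFDerivAt X hWd
  have hq : HasFDerivAt (fun X => Nu δ f X / Wt δ X)
      ((Wt δ X ^ 2)⁻¹ • (Wt δ X • dN δ f X - Nu δ f X • dN δ (fun _ => 1) X)) X := by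
    refine (hN.mul hinv).congr_fderiv ?_
    ext v
    simp
    field_simp
    ring
  have hdiv := hq.congr_of_eventuallyEq hev
  refine ⟨hdiv.differentiableAt, ?_⟩
  rw [hdiv.fderiv]
  have e : Wt δ X • dN δ f X - Nu δ f X • dN δ (fun _ => 1) X =
      Wt δ X • dN δ (fun Y => f Y - f X) X - Nu δ (fun Y => f Y - f X) X • dN δ (fun _ => 1) X := by
    rw [Nu_sub_const h hf, dN_sub_const h hf]
    ext v; simp; ring
  have hη0 : 0 ≤ η := (abs_nonneg _).trans (hη X (by simpa using hX.le))
  have b1 := dN_le h (g := fun Y => f Y - f X) hη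
  have b2 := dN_le h (η := 1) (X := X) (g := fun _ => 1) (by simp)
  have b3 := Nu_le h (g := fun Y => f Y - f X) hη
  have b4 := Wt_lower h X
  have hV : 0 ≤ Vol δ X := measureReal_nonneg
  have key : ‖Wt δ X • dN δ f X - Nu δ f X • dN δ (fun _ => 1) X‖ ≤
      8 * η * δ X ^ 3 * Vol δ X * Wt δ X := by
    rw [e]
    refine (norm_sub_le _ _).trans ?_
    rw [norm_smul, norm_smul, Real.norm_of_nonneg hW.le, Real.norm_eq_abs]
    have c1 := mul_le_mul_of_nonneg_left b1 hW.le
    have c2 := mul_le_mul b3 b2 (norm_nonneg _) (by positivity)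
    refine (add_le_add c1 c2).trans (le_of_eq ?_)
    ring
  have goal2 : (8 * η * δ X ^ 3 * Vol δ X * Wt δ X) / Wt δ X ^ 2 ≤ 512 * 8 ^ d * η / δ X := by
    rw [div_le_div_iff₀ (by positivity) hX]
    have := mul_le_mul_of_nonneg_left b4 (show 0 ≤ 8 * η * Wt δ X by positivity)
    linarith
  refine le_trans ?_ goal2
  rw [div_eq_inv_mul, norm_smul, Real.norm_of_nonneg (by positivity)]
  gcongr

lemma av_holder (h : IsDistLike δ) {f : EE d → ℝ} {lam τ : ℝ} (hl : 0 < lam) (hl1 : lam < 1) (hτ : 0 ≤ τ)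
    (hf : ∀ X Y, |f X - f Y| ≤ τ * ‖X - Y‖ ^ lam) : Continuous f ∧
    (∀ X, |av δ f X - f X| ≤ τ * δ X ^ lam) ∧
    (∀ X, 0 < δ X → DifferentiableAt ℝ (av δ f) X ∧
      ‖fderiv ℝ (av δ f) X‖ ≤ 512 * 8 ^ d * τ * δ X ^ (lam - 1)) ∧
    ∀ X Y, |av δ f X - av δ f Y| ≤ τ * (6 + 512 * 8 ^ d) * ‖X - Y‖ ^ lam := by
  have hc : Continuous f := by
    rw [continuous_iff_continuousAt]
    intro X
    rw [ContinuousAt, tendsto_iff_dist_tendsto_zero]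
    refine squeeze_zero (g := fun Y => τ * ‖Y - X‖ ^ lam) (fun _ => dist_nonneg) (fun Y => hf Y X) ?_
    have : Continuous fun Y : EE d => τ * ‖Y - X‖ ^ lam :=
      continuous_const.mul ((continuous_id.sub continuous_const).norm.rpow_const fun _ => Or.inr hl.le)
    simpa [Real.zero_rpow hl.ne'] using this.tendsto X
  have hη : ∀ X Y, ‖X - Y‖ ≤ δ X → |f Y - f X| ≤ τ * δ X ^ lam := by
    intro X Y hXY
    refine (hf Y X).trans ?_
    rw [norm_sub_rev]
    gcongr
  have h1 : ∀ X, |av δ f X - f X| ≤ τ * δ X ^ lam := fun X =>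
    av_close h hc (hη X) (by have := h.nn X; positivity)
  have h2 : ∀ X, 0 < δ X → DifferentiableAt ℝ (av δ f) X ∧
      ‖fderiv ℝ (av δ f) X‖ ≤ 512 * 8 ^ d * τ * δ X ^ (lam - 1) := by
    intro X hX
    obtain ⟨a, b⟩ := av_deriv h hc (hη X) hX
    refine ⟨a, b.trans (le_of_eq ?_)⟩
    rw [Real.rpow_sub_one hX.ne']
    ring
  refine ⟨hc, h1, h2, fun X Y => ?_⟩
  rcases eq_or_ne X Y with rfl | hne
  · simp [Real.zero_rpow hl.ne']
  have hr : 0 < ‖X - Y‖ := norm_pos_iff.2 (sub_ne_zero.2 hne)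
  set r := ‖X - Y‖ with hrd
  have hrl : 0 < r ^ lam := Real.rpow_pos_of_pos hr _
  rcases le_or_gt (δ X) (2 * r) with hs | hs
  · have hY : δ Y ≤ 3 * r := by
      have := h.lip Y X
      rw [norm_sub_rev] at this; linarith
    have hk : ∀ Z (k : ℝ), 1 ≤ k → δ Z ≤ k * r → |av δ f Z - f Z| ≤ τ * (k * r ^ lam) := by
      intro Z k hk hZ
      refine (h1 Z).trans (mul_le_mul_of_nonneg_left ?_ hτ)
      calc δ Z ^ lam ≤ (k * r) ^ lam := Real.rpow_le_rpow (h.nn Z) hZ hl.le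
        _ = k ^ lam * r ^ lam := Real.mul_rpow (by linarith) hr.le
        _ ≤ k * r ^ lam := by
          gcongr
          calc k ^ lam ≤ k ^ (1 : ℝ) := Real.rpow_le_rpow_of_exponent_le hk hl1.le
            _ = k := Real.rpow_one k
    have a1 := abs_le.1 (hk X 2 (by norm_num) hs)
    have a2 := abs_le.1 (hk Y 3 (by norm_num) hY)
    have a3 := abs_le.1 (hf X Y)
    have a4 : 0 ≤ τ * (512 * 8 ^ d) * r ^ lam := by positivity
    rw [abs_le]
    constructor <;> nlinarith
  · have hball : ∀ Z ∈ closedBall X r, r ≤ δ Z := by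
      intro Z hZ
      rw [mem_closedBall, dist_eq_norm] at hZ
      have := h.lip X Z
      rw [norm_sub_rev] at this
      linarith
    have hmv := (convex_closedBall X r).norm_image_sub_le_of_norm_fderiv_le (𝕜 := ℝ) (f := av δ f)
      (C := 512 * 8 ^ d * τ * r ^ (lam - 1)) (x := Y) (y := X)
      (fun Z hZ => (h2 Z (hr.trans_le (hball Z hZ))).1)
      (fun Z hZ => (h2 Z (hr.trans_le (hball Z hZ))).2.trans (by
        have := Real.rpow_le_rpow_of_nonpos hr (hball Z hZ) (show lam - 1 ≤ 0 by linarith)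
        gcongr))
      (by rw [mem_closedBall, dist_eq_norm, norm_sub_rev])
      (mem_closedBall_self hr.le)
    rw [Real.norm_eq_abs, ← hrd] at hmv
    refine hmv.trans ?_
    rw [mul_assoc, ← Real.rpow_add_one hr.ne']
    simp only [sub_add_cancel]
    nlinarith [mul_nonneg hτ hrl.le]

lemma av_sum {ι : Type*} (h : IsDistLike δ) (s : Finset ι) (f : ι → EE d → ℝ)
    (hf : ∀ i ∈ s, Continuous (f i)) (X : EE d) :
    av δ (fun Y => ∑ i ∈ s, f i Y) X = ∑ i ∈ s, av δ (f i) X := by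
  unfold av
  split_ifs
  · rfl
  · rw [← Finset.sum_div]
    congr 1
    simp only [Nu, Finset.sum_mul]
    exact integral_finsetSum _ fun i hi => integrable_gw h (hf i hi) X

lemma av_mul (f : EE d → ℝ) (c : ℝ) (X : EE d) :
    av δ (fun Y => f Y * c) X = av δ f X * c := by
  unfold av
  split_ifs
  · rfl
  · have : Nu δ (fun Y => f Y * c) X = Nu δ f X * c := by
      simp only [Nu]
      rw [← integral_mul_const]
      congr 1; ext Y; ring
    rw [this]; ring

lemma av_mem (h : IsDistLike δ) {f : EE d → ℝ} (hf : Continuous f) {a b : ℝ}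
    (hab : ∀ X, a ≤ f X ∧ f X ≤ b) (X : EE d) : a ≤ av δ f X ∧ av δ f X ≤ b := by
  unfold av
  split_ifs with hX
  · exact hab X
  · have hp := Wt_pos h (lt_of_le_of_ne (h.nn X) (Ne.symm hX))
    rw [le_div_iff₀ hp, div_le_iff₀ hp]
    simp only [Nu, Wt]
    rw [← integral_const_mul, ← integral_const_mul]
    constructor
    · exact integral_mono ((integrable_w h X).const_mul a) (integrable_gw h hf X)
        fun Y => mul_le_mul_of_nonneg_right (hab Y).1 (sq_nonneg _)
    · exact integral_mono (integrable_gw h hf X) ((integrable_w h X).const_mul b)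
        fun Y => mul_le_mul_of_nonneg_right (hab Y).2 (sq_nonneg _)

lemma av_periodic {f : EE d → ℝ} {Z : EE d} (hδ : ∀ X, δ (X + Z) = δ X) (hf : ∀ X, f (X + Z) = f X)
    (X : EE d) : av δ f (X + Z) = av δ f X := by
  have hw : ∀ Y, wt δ (X + Z) (Y + Z) = wt δ X Y := fun Y => by simp [wt, pp, hδ]
  have h1 : Nu δ f (X + Z) = Nu δ f X := by
    simp only [Nu]
    rw [← integral_add_right_eq_self _ Z]
    simp only [hw, hf]
  have h2 : Wt δ (X + Z) = Wt δ X := by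
    simp only [Wt]
    rw [← integral_add_right_eq_self _ Z]
    simp only [hw]
  simp only [av, hδ, hf, h1, h2]

/-- Periodized set -/
def perSet (S : Set (EE d)) : Set (EE d) :=
  {X | ∃ Z : EE d, (∀ i, ∃ k : ℤ, Z i = (k : ℝ)) ∧ X + Z ∈ S}

lemma isDistLike_infDist (S : Set (EE d)) : IsDistLike (fun X => infDist X S) :=
  ⟨fun _ => infDist_nonneg, fun X Y => by rw [← dist_eq_norm]; exact infDist_le_infDist_add_dist⟩

lemma perSet_infDist_le (S : Set (EE d)) {Z : EE d} (hZ : ∀ i, ∃ k : ℤ, Z i = (k : ℝ)) (X : EE d) :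
    infDist (X + Z) (perSet S) ≤ infDist X (perSet S) := by
  rcases (perSet S).eq_empty_or_nonempty with he | hne
  · simp [he]
  · rw [le_infDist hne]
    rintro P ⟨Z', hZ', hP⟩
    have : P + Z ∈ perSet S := by
      refine ⟨Z' - Z, fun i => ?_, by simpa using hP⟩
      obtain ⟨k, hk⟩ := hZ i
      obtain ⟨l, hl⟩ := hZ' i
      exact ⟨l - k, by simp [hk, hl]⟩
    refine (infDist_le_dist_of_mem this).trans (le_of_eq ?_)
    simp

lemma perSet_infDist (S : Set (EE d)) {Z : EE d} (hZ : ∀ i, ∃ k : ℤ, Z i = (k : ℝ)) (X : EE d) :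
    infDist (X + Z) (perSet S) = infDist X (perSet S) := by
  refine le_antisymm (perSet_infDist_le S hZ X) ?_
  have := perSet_infDist_le S (Z := -Z) (fun i => by
    obtain ⟨k, hk⟩ := hZ i
    exact ⟨-k, by simp [hk]⟩) (X + Z)
  simpa using this

lemma perSet_lower {S : Set (EE d)} (hS : S.Nonempty) (hb : ∀ P ∈ S, ‖P‖ ≤ 1 / 4) {X : EE d}
    (hX : ∀ i, X i ∈ Set.Icc (-(1 / 2) : ℝ) (1 / 2)) :
    (1 / (2 * d + 1)) * infDist X S ≤ infDist X (perSet S) := by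
  have hc1 : (1 : ℝ) / (2 * d + 1) ≤ 1 := by
    rw [div_le_one (by positivity)]; linarith [(Nat.cast_nonneg d : (0 : ℝ) ≤ d)]
  have hc0 : (0 : ℝ) < 1 / (2 * d + 1) := by positivity
  have hne : (perSet S).Nonempty := by
    obtain ⟨P, hP⟩ := hS
    exact ⟨P, 0, fun i => ⟨0, by simp⟩, by simpa using hP⟩
  rw [le_infDist hne]
  rintro P ⟨Z, hZ, hP⟩
  by_cases h0 : Z = 0
  · subst h0
    rw [add_zero] at hP
    have := infDist_le_dist_of_mem (x := X) hP
    have h2 := infDist_nonneg (x := X) (s := S)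
    nlinarith
  · have : ∃ i, Z i ≠ 0 := by
      by_contra hc
      push Not at hc
      exact h0 (by ext i; simpa using hc i)
    obtain ⟨i, hi⟩ := this
    obtain ⟨k, hk⟩ := hZ i
    have hk0 : k ≠ 0 := by rintro rfl; simp [hk] at hi
    have hk1 : (1 : ℝ) ≤ |(k : ℝ)| := by
      rw [← Int.cast_abs]; exact_mod_cast Int.one_le_abs hk0
    have hPi : |(P + Z) i| ≤ 1 / 4 := by
      have := PiLp.norm_apply_le (P + Z) i
      rw [Real.norm_eq_abs] at this
      exact this.trans (hb _ hP)
    have hXi : |X i| ≤ 1 / 2 := abs_le.2 ⟨(hX i).1, (hX i).2⟩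
    have hd1 : |(X - P) i| ≤ dist X P := by
      have := PiLp.norm_apply_le (X - P) i
      rwa [Real.norm_eq_abs, ← dist_eq_norm] at this
    have hd2 : 1 / 4 ≤ dist X P := by
      refine le_trans ?_ hd1
      have e : (k : ℝ) = (P + Z) i - X i + (X - P) i := by simp [hk]
      have := abs_add_le ((P + Z) i - X i) ((X - P) i)
      have h3 := abs_sub ((P + Z) i) (X i)
      rw [← e] at this
      linarith
    have hXn : ‖X‖ ≤ d * (1 / 2) := by
      have h1 : ‖X‖ ≤ ∑ i, |X i| := by
        have := norm_sum_le Finset.univ (fun i => X i • EuclideanSpace.single i (1 : ℝ))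
        have e : ∑ i, X i • EuclideanSpace.single i (1 : ℝ) = X := by
          ext j; simp [Finset.sum_apply, Pi.single_apply]
        rw [e] at this
        simpa [norm_smul] using this
      refine h1.trans ?_
      calc ∑ i, |X i| ≤ ∑ i : Fin d, (1 / 2 : ℝ) :=
            Finset.sum_le_sum fun i _ => abs_le.2 ⟨(hX i).1, (hX i).2⟩
        _ = _ := by simp
    have hI : infDist X S ≤ (2 * d + 1) / 4 := by
      refine (infDist_le_dist_of_mem hP).trans ?_
      rw [dist_eq_norm]
      refine (norm_sub_le _ _).trans ?_
      have := hb _ hP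
      linarith
    refine le_trans ?_ hd2
    calc 1 / (2 * (d : ℝ) + 1) * infDist X S ≤ 1 / (2 * (d : ℝ) + 1) * ((2 * d + 1) / 4) := by gcongr
      _ = 1 / 4 := by field_simp

end helpers

/-- **Lemma 7.1** (construction of a regularized coefficient matrix): given
`A ∈ Λ(μ,λ,τ)` and a bounded Lipschitz domain `Ω` with `0 ∈ Ω` and `diam(Ω) ≤ 1/4`, there
is `Ā ∈ Λ(μ,lam₀,τ₀)` which agrees with `A` on `∂Ω`, is `C¹` on `[−1/2,1/2]^d∖∂Ω` with
`|∇Ā(X)| ≤ C₁ dist(X,∂Ω)^{lam₀−1}`, and is symmetric whenever `A` is; here `lam₀ ∈ (0,λ]` and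
`τ₀, C₁` depend only on `μ,λ,τ` and the Lipschitz character of `Ω`. -/
theorem statement_17
    (d m : ℕ) (hd : 3 ≤ d) (hm : 1 ≤ m)
    (μ lam τ M : ℝ) (N : ℕ)
    (hμ : 0 < μ) (hlam : lam ∈ Set.Ioo (0 : ℝ) 1) (hτ : 0 ≤ τ) :
    ∃ lam₀ τ₀ C₁ : ℝ, 0 < lam₀ ∧ lam₀ ≤ lam ∧ 0 ≤ τ₀ ∧ 0 < C₁ ∧
      ∀ Ω : Set (EuclideanSpace ℝ (Fin d)),
        MemLipschitzClass d M N Ω →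
        (0 : EuclideanSpace ℝ (Fin d)) ∈ Ω → Metric.diam Ω ≤ 1 / 4 →
      ∀ A : Coeff d m, MemLambdaClass μ lam τ A →
      ∃ Abar : Coeff d m,
        MemLambdaClass μ lam₀ τ₀ Abar ∧
        (∀ P ∈ frontier Ω, Abar P = A P) ∧
        (∀ X ∈ {X : EuclideanSpace ℝ (Fin d) |
            ∀ i, X i ∈ Set.Icc (-(1 / 2) : ℝ) (1 / 2)} \ frontier Ω,
          ∀ i j α β, DifferentiableAt ℝ (fun Z => Abar Z i j α β) X) ∧
        (∀ X ∈ {X : EuclideanSpace ℝ (Fin d) |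
            ∀ i, X i ∈ Set.Icc (-(1 / 2) : ℝ) (1 / 2)} \ frontier Ω,
          ∀ i j α β, ‖fderiv ℝ (fun Z => Abar Z i j α β) X‖ ≤
            C₁ * Metric.infDist X (frontier Ω) ^ (lam₀ - 1)) ∧
        (IsSymmCoeff A → IsSymmCoeff Abar) := by
  have hl0 := hlam.1
  have hl1 := hlam.2
  refine ⟨lam, τ * (6 + 512 * 8 ^ d),
    512 * 8 ^ d * (τ + 1) * (1 / (2 * (d : ℝ) + 1)) ^ (lam - 1), hl0, le_rfl, by positivity,
    by positivity, ?_⟩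
  intro Ω hΩ h0 hdiam A hA
  obtain ⟨-, hbdd, hne, -⟩ := hΩ
  obtain ⟨hell, hper, hhol⟩ := hA
  have hS : (frontier Ω).Nonempty := by
    haveI : Nonempty (Fin d) := ⟨⟨0, by omega⟩⟩
    rw [nonempty_frontier_iff]
    refine ⟨hne, ?_⟩
    rintro rfl
    exact NormedSpace.unbounded_univ ℝ (EE d) hbdd
  have hb : ∀ P ∈ frontier Ω, ‖P‖ ≤ 1 / 4 := by
    intro P hP
    have h1 := dist_le_diam_of_mem hbdd.closure (frontier_subset_closure hP) (subset_closure h0)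
    rw [diam_closure, dist_zero_right] at h1
    exact h1.trans hdiam
  set δ : EE d → ℝ := fun X => infDist X (perSet (frontier Ω)) with hδ
  have hD : IsDistLike δ := isDistLike_infDist _
  have H := fun i j α β => av_holder (f := fun X => A X i j α β) hD hl0 hl1 hτ
    (fun X Y => hhol X Y i j α β)
  have hpos : ∀ X ∈ {X : EE d | ∀ i, X i ∈ Set.Icc (-(1 / 2) : ℝ) (1 / 2)} \ frontier Ω,
      0 < infDist X (frontier Ω) ∧ 1 / (2 * (d : ℝ) + 1) * infDist X (frontier Ω) ≤ δ X :=
    fun X hX => ⟨(isClosed_frontier.notMem_iff_infDist_pos hS).1 hX.2, perSet_lower hS hb hX.1⟩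
  have hpos2 : ∀ X ∈ {X : EE d | ∀ i, X i ∈ Set.Icc (-(1 / 2) : ℝ) (1 / 2)} \ frontier Ω,
      0 < δ X := fun X hX =>
    lt_of_lt_of_le (mul_pos (by positivity) (hpos X hX).1) (hpos X hX).2
  refine ⟨fun X i j α β => av δ (fun Y => A Y i j α β) X, ⟨?_, ?_, ?_⟩, ?_, ?_, ?_, ?_⟩
  · intro X ξ
    have e : (∑ i, ∑ j, ∑ α, ∑ β, av δ (fun Y => A Y i j α β) X * ξ i α * ξ j β) =
        av δ (fun Y => ∑ i, ∑ j, ∑ α, ∑ β, A Y i j α β * ξ i α * ξ j β) X := by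
      have hc : ∀ i j α β, Continuous fun Y => A Y i j α β * ξ i α * ξ j β := fun i j α β =>
        ((H i j α β).1.mul continuous_const).mul continuous_const
      have hc1 : ∀ i j α, Continuous fun Y => ∑ β, A Y i j α β * ξ i α * ξ j β := fun i j α =>
        continuous_finsetSum _ fun β _ => hc i j α β
      have hc2 : ∀ i j, Continuous fun Y => ∑ α, ∑ β, A Y i j α β * ξ i α * ξ j β := fun i j =>
        continuous_finsetSum _ fun α _ => hc1 i j α
      have hc3 : ∀ i, Continuous fun Y => ∑ j, ∑ α, ∑ β, A Y i j α β * ξ i α * ξ j β := fun i =>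
        continuous_finsetSum _ fun j _ => hc2 i j
      rw [av_sum hD _ _ (fun i _ => hc3 i)]
      refine Finset.sum_congr rfl fun i _ => ?_
      rw [av_sum hD _ _ (fun j _ => hc2 i j)]
      refine Finset.sum_congr rfl fun j _ => ?_
      rw [av_sum hD _ _ (fun α _ => hc1 i j α)]
      refine Finset.sum_congr rfl fun α _ => ?_
      rw [av_sum hD _ _ (fun β _ => hc i j α β)]
      refine Finset.sum_congr rfl fun β _ => ?_
      rw [av_mul, av_mul]
    have hc : Continuous fun Y => ∑ i, ∑ j, ∑ α, ∑ β, A Y i j α β * ξ i α * ξ j β :=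
      continuous_finsetSum _ fun i _ => continuous_finsetSum _ fun j _ =>
        continuous_finsetSum _ fun α _ => continuous_finsetSum _ fun β _ =>
          ((H i j α β).1.mul continuous_const).mul continuous_const
    have := av_mem hD hc (fun Y => hell Y ξ) X
    rw [← e] at this
    exact this
  · intro X Z hZ
    funext i j α β
    exact av_periodic (fun Y => perSet_infDist _ hZ Y) (fun Y => by rw [hper Y Z hZ]) X
  · intro X Y i j α β
    exact (H i j α β).2.2.2 X Y
  · intro P hP
    have : δ P = 0 := infDist_zero_of_mem ⟨0, fun i => ⟨0, by simp⟩, by simpa using hP⟩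
    funext i j α β
    simp only [av, this, if_true]
  · intro X hX i j α β
    exact ((H i j α β).2.2.1 X (hpos2 X hX)).1
  · intro X hX i j α β
    refine ((H i j α β).2.2.1 X (hpos2 X hX)).2.trans ?_
    obtain ⟨h1, h2⟩ := hpos X hX
    have h3 := Real.rpow_le_rpow_of_nonpos (mul_pos (by positivity) h1) h2
      (show lam - 1 ≤ 0 by linarith)
    rw [Real.mul_rpow (by positivity) h1.le] at h3
    rw [mul_assoc _ _ (infDist X (frontier Ω) ^ (lam - 1))]
    have h4 : (0 : ℝ) ≤ δ X ^ (lam - 1) := Real.rpow_nonneg (hD.nn X) _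
    refine mul_le_mul ?_ h3 h4 (by positivity)
    gcongr
    linarith
  · intro hsym X i j α β
    have : (fun Y => A Y i j α β) = fun Y => A Y j i β α := by
      funext Y; exact hsym Y i j α β
    simp only [this]

end
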